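/- Among all trees with n vertices and even diameter d = 2k (k ≥ 1), the tree with the minimum distance spectral radius is uniquely T_2, the tree obtained by attaching n − 2k − 1 pendant vertices to the central vertex v_0 of the path v_k ⋯ v_1 v_0 u_1 ⋯ u_k. That is, for every tree T on n vertices with diameter 2k, ϱ(T) ≥ ϱ(T_2), with equality if and only if T is isomorphic to T_2. -/

import Mathlib

open SimpleGraph

/-- The distance matrix of a graph: the (i,j)-entry is the graph distance between i and j. -/
noncomputable def distMatrix {V : Type*} [Fintype V] (G : SimpleGraph V) : Matrix V V ℝ :=
  fun i j => (G.dist i j : ℝ)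

/-- The distance spectral radius: the largest eigenvalue of the distance matrix. -/
noncomputable def distSpectralRadius {V : Type*} [Fintype V] (G : SimpleGraph V) : ℝ :=
  sSup {μ : ℝ | ∃ X : V → ℝ, X ≠ 0 ∧ (distMatrix G).mulVec X = μ • X}

/-- The distance Perron vector: the positive unit eigenvector of the distance matrix
corresponding to the distance spectral radius. -/
def IsDistPerronVector {V : Type*} [Fintype V] (G : SimpleGraph V) (X : V → ℝ) : Prop :=
  (∀ v, 0 < X v) ∧ (∑ v, (X v) ^ 2 = 1) ∧
    (distMatrix G).mulVec X = distSpectralRadius G • X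

/-- The tree `T₂`: the path `v_k ⋯ v_1 v_0 u_1 ⋯ u_k` on `2k+1` vertices together with `m`
pendant vertices attached at the central vertex `v_0`.  Here `Sum.inl i` is `v_i`,
`Sum.inr (Sum.inl i)` is `u_{i+1}`, and `Sum.inr (Sum.inr j)` are the pendant vertices. -/
def treeT2 (k m : ℕ) : SimpleGraph (Fin (k + 1) ⊕ (Fin k ⊕ Fin m)) :=
  SimpleGraph.fromRel (fun a b =>
    match a, b with
    | Sum.inl i, Sum.inl j => (i : ℕ) + 1 = (j : ℕ)
    | Sum.inr (Sum.inl i), Sum.inr (Sum.inl j) => (i : ℕ) + 1 = (j : ℕ)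
    | Sum.inl i, Sum.inr (Sum.inl j) => (i : ℕ) = 0 ∧ (j : ℕ) = 0
    | Sum.inl i, Sum.inr (Sum.inr _) => (i : ℕ) = 0
    | _, _ => False)

section Spectral
variable {V : Type*} [Fintype V]

theorem distMatrix_isHermitian (G : SimpleGraph V) : (distMatrix G).IsHermitian := by
  ext i j
  simp [distMatrix, SimpleGraph.dist_comm]

theorem dsr_isGreatest [Nonempty V] (G : SimpleGraph V) :
    IsGreatest {μ : ℝ | ∃ X : V → ℝ, X ≠ 0 ∧ (distMatrix G).mulVec X = μ • X}
      (distSpectralRadius G) := by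
  classical
  have hfin : {μ : ℝ | ∃ X : V → ℝ, X ≠ 0 ∧ (distMatrix G).mulVec X = μ • X}.Finite := by
    refine (Module.End.finite_hasEigenvalue (Matrix.toLin' (distMatrix G))).subset ?_
    rintro μ ⟨X, hX, h⟩
    exact Module.End.hasEigenvalue_of_hasEigenvector
      (x := X) ⟨Module.End.mem_eigenspace_iff.2 (by simpa using h), hX⟩
  have hne : {μ : ℝ | ∃ X : V → ℝ, X ≠ 0 ∧ (distMatrix G).mulVec X = μ • X}.Nonempty := by
    have hH := distMatrix_isHermitian G
    obtain ⟨j⟩ := ‹Nonempty V›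
    refine ⟨hH.eigenvalues j, _, ?_, hH.mulVec_eigenvectorBasis j⟩
    intro h0
    apply hH.eigenvectorBasis.orthonormal.ne_zero j
    ext i
    exact congrFun h0 i
  exact ⟨hne.csSup_mem hfin, fun μ hμ => le_csSup hfin.bddAbove hμ⟩

theorem dsr_posSemidef [Nonempty V] [DecidableEq V] (G : SimpleGraph V) :
    (distSpectralRadius G • (1 : Matrix V V ℝ) - distMatrix G).PosSemidef := by
  have hH : (distSpectralRadius G • (1 : Matrix V V ℝ) - distMatrix G).IsHermitian := by
    refine Matrix.IsHermitian.sub ?_ (distMatrix_isHermitian G)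
    ext i j
    simp [Matrix.one_apply, eq_comm]
  rw [hH.posSemidef_iff_eigenvalues_nonneg]
  intro j
  have h := hH.mulVec_eigenvectorBasis j
  have h0 : (⇑(hH.eigenvectorBasis j) : V → ℝ) ≠ 0 := by
    intro h0
    apply hH.eigenvectorBasis.orthonormal.ne_zero j
    ext i
    exact congrFun h0 i
  have : distSpectralRadius G - hH.eigenvalues j ≤ distSpectralRadius G := by
    apply (dsr_isGreatest G).2
    refine ⟨_, h0, ?_⟩
    rw [Matrix.sub_mulVec, Matrix.smul_mulVec, Matrix.one_mulVec] at h
    rw [sub_smul, ← h]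
    abel
  simp only [Pi.zero_apply]
  linarith

theorem dsr_form_eq [DecidableEq V] (G : SimpleGraph V) (Y : V → ℝ) :
    Y ⬝ᵥ ((distSpectralRadius G • (1 : Matrix V V ℝ) - distMatrix G).mulVec Y)
      = distSpectralRadius G * ∑ v, Y v ^ 2 - ∑ v, ∑ w, Y v * Y w * (G.dist v w : ℝ) := by
  rw [Matrix.sub_mulVec, Matrix.smul_mulVec, Matrix.one_mulVec, dotProduct_sub, dotProduct_smul]
  simp only [dotProduct, Matrix.mulVec, distMatrix, smul_eq_mul, Finset.mul_sum]
  congr 1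
  · refine Finset.sum_congr rfl fun v _ => by ring
  · refine Finset.sum_congr rfl fun v _ => Finset.sum_congr rfl fun w _ => by ring

theorem dsr_rayleigh [Nonempty V] (G : SimpleGraph V) (Y : V → ℝ) :
    ∑ v, ∑ w, Y v * Y w * (G.dist v w : ℝ) ≤ distSpectralRadius G * ∑ v, Y v ^ 2 := by
  classical
  have := (dsr_posSemidef G).dotProduct_mulVec_nonneg Y
  rw [star_trivial, dsr_form_eq] at this
  linarith

/-- A positive eigenvector for the distance spectral radius. -/
theorem dsr_perron [Nontrivial V] (G : SimpleGraph V) (hG : G.Connected) :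
    ∃ X : V → ℝ, (∀ v, 0 < X v) ∧
      ∀ v, ∑ w, (G.dist v w : ℝ) * X w = distSpectralRadius G * X v := by
  classical
  obtain ⟨Y, hY, hE⟩ := (dsr_isGreatest G).1
  have hE' : ∀ v, ∑ w, (G.dist v w : ℝ) * Y w = distSpectralRadius G * Y v := fun v => by
    have := congrFun hE v
    simpa [Matrix.mulVec, dotProduct, distMatrix] using this
  have hEq : ∑ v, ∑ w, Y v * Y w * (G.dist v w : ℝ) = distSpectralRadius G * ∑ v, Y v ^ 2 := by
    rw [Finset.mul_sum]
    refine Finset.sum_congr rfl fun v _ => ?_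
    calc _ = Y v * ∑ w, (G.dist v w : ℝ) * Y w := by
          rw [Finset.mul_sum]; exact Finset.sum_congr rfl fun w _ => by ring
      _ = _ := by rw [hE']; ring
  have hle : ∑ v, ∑ w, Y v * Y w * (G.dist v w : ℝ) ≤
      ∑ v, ∑ w, |Y v| * |Y w| * (G.dist v w : ℝ) := by
    refine Finset.sum_le_sum fun v _ => Finset.sum_le_sum fun w _ => ?_
    rw [← abs_mul]
    exact mul_le_mul_of_nonneg_right (le_abs_self _) (Nat.cast_nonneg _)
  have hge := dsr_rayleigh G (fun v => |Y v|)
  simp only [sq_abs] at hge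
  have hz := (dsr_posSemidef G).dotProduct_mulVec_zero_iff (fun v => |Y v|)
  rw [star_trivial, dsr_form_eq] at hz
  simp only [sq_abs] at hz
  have hz2 := hz.1 (by linarith)
  rw [Matrix.sub_mulVec, Matrix.smul_mulVec, Matrix.one_mulVec] at hz2
  have hE2 : ∀ v, ∑ w, (G.dist v w : ℝ) * |Y w| = distSpectralRadius G * |Y v| := fun v => by
    have := congrFun hz2 v
    simp [Matrix.mulVec, dotProduct, distMatrix] at this
    linarith
  refine ⟨fun v => |Y v|, fun v => ?_, hE2⟩
  rcases (abs_nonneg (Y v)).lt_or_eq with h | h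
  · exact h
  exfalso
  apply hY
  have h3 := hE2 v
  rw [← h, mul_zero, Finset.sum_eq_zero_iff_of_nonneg
    (fun w _ => mul_nonneg (Nat.cast_nonneg _) (abs_nonneg _))] at h3
  ext w
  by_cases hw : v = w
  · subst hw; simpa using h.symm
  · have h4 := h3 w (Finset.mem_univ _)
    have h5 := hG.pos_dist_of_ne hw
    rcases mul_eq_zero.1 h4 with h6 | h6
    · have : G.dist v w = 0 := by exact_mod_cast h6
      omega
    · simpa using h6

theorem dist_iso {V W : Type*} {G : SimpleGraph V} {H : SimpleGraph W} (hG : G.Connected)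
    (hH : H.Connected) (f : G ≃g H) (a b : V) : H.dist (f a) (f b) = G.dist a b := by
  apply le_antisymm
  · obtain ⟨p, hp⟩ := hG.exists_walk_length_eq_dist a b
    have := SimpleGraph.dist_le (p.map f.toHom)
    rw [SimpleGraph.Walk.length_map, hp] at this
    exact this
  · obtain ⟨p, hp⟩ := hH.exists_walk_length_eq_dist (f a) (f b)
    have := SimpleGraph.dist_le (p.map f.symm.toHom)
    rw [SimpleGraph.Walk.length_map, hp] at this
    simpa using this

theorem dsr_iso_le {V W : Type*} [Fintype V] [Fintype W] [Nonempty V] [Nonempty W]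
    {G : SimpleGraph V} {H : SimpleGraph W} (hG : G.Connected)
    (hH : H.Connected) (f : G ≃g H) : distSpectralRadius G ≤ distSpectralRadius H := by
  obtain ⟨Y, hY, hE⟩ := (dsr_isGreatest G).1
  refine (dsr_isGreatest H).2 ⟨fun w => Y (f.symm w), ?_, ?_⟩
  · intro h0
    apply hY
    ext v
    simpa using congrFun h0 (f v)
  · ext w
    have h := congrFun hE (f.symm w)
    simp only [Matrix.mulVec, dotProduct, distMatrix, Pi.smul_apply] at h ⊢
    rw [← h, ← Equiv.sum_comp f.toEquiv]
    refine Finset.sum_congr rfl fun v _ => ?_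
    have := dist_iso hG hH f (f.symm w) v
    simp at this
    simp [this]

end Spectral

section Tree
variable {V : Type*} {T : SimpleGraph V}

theorem tree_adj_dist (hT : T.IsTree) {u v : V} (h : T.Adj u v) (z : V) :
    T.dist u z = T.dist v z + 1 ∨ T.dist v z = T.dist u z + 1 := by
  have := hT.dist_eq_dist_add_one_of_adj z h
  simpa [SimpleGraph.dist_comm] using this

theorem tree_closer_unique (hT : T.IsTree) {w y y' z : V} (h : T.Adj w y) (h' : T.Adj w y')
    (hd : T.dist y z < T.dist w z) (hd' : T.dist y' z < T.dist w z) : y = y' := by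
  obtain ⟨p, hp⟩ := hT.connected.exists_walk_length_eq_dist y z
  obtain ⟨p', hp'⟩ := hT.connected.exists_walk_length_eq_dist y' z
  have e1 := tree_adj_dist hT h z
  have e2 := tree_adj_dist hT h' z
  have q := (SimpleGraph.Walk.cons h p).isPath_of_length_eq_dist
    (by rw [SimpleGraph.Walk.length_cons]; omega)
  have q' := (SimpleGraph.Walk.cons h' p').isPath_of_length_eq_dist
    (by rw [SimpleGraph.Walk.length_cons]; omega)
  have := hT.isAcyclic.path_unique ⟨_, q⟩ ⟨_, q'⟩
  have h3 := congrArg Subtype.val this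
  simp only [SimpleGraph.Walk.cons.injEq] at h3
  exact h3.1

theorem exists_closer (hT : T.Connected) {w z : V} (h : w ≠ z) :
    ∃ y, T.Adj w y ∧ T.dist w z = T.dist y z + 1 := by
  obtain ⟨p, hp⟩ := hT.exists_walk_length_eq_dist w z
  cases p with
  | nil => exact absurd rfl h
  | @cons _ y _ hadj q =>
    refine ⟨y, hadj, ?_⟩
    rw [SimpleGraph.Walk.length_cons] at hp
    have h1 := SimpleGraph.dist_le q
    have h2 := hT.dist_triangle (u := w) (v := y) (w := z)
    have h3 := SimpleGraph.dist_eq_one_iff_adj.2 hadj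
    omega

theorem tree_edge_cross (hT : T.IsTree) {w w' z z' : V} (h : T.Adj w w') (hz : T.Adj z z')
    (h1 : T.dist w z < T.dist w' z) (h2 : T.dist w' z' < T.dist w z') : z = w := by
  by_contra hne
  obtain ⟨y, hy, hyd⟩ := exists_closer hT.connected (Ne.symm hne)
  have e1 := tree_adj_dist hT h z
  have e2 := tree_adj_dist hT h z'
  have hz1 := SimpleGraph.dist_eq_one_iff_adj.2 hz
  have t1 := hT.connected.dist_triangle (u := w) (v := z) (w := z')
  have t2 := hT.connected.dist_triangle (u := w') (v := z') (w := z)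
  rw [SimpleGraph.dist_comm (u := z') (v := z)] at t2
  have t3 := hT.connected.dist_triangle (u := y) (v := z) (w := z')
  have := tree_closer_unique hT hy h (z := z') (by omega) h2
  subst this
  omega

/-- Off-path vertices see the whole path through the parent. -/
theorem tree_parent_path (hT : T.IsTree) {N c : ℕ} {q : ℕ → V} (hc : c ≤ N)
    (hq : ∀ i, i < N → T.Adj (q i) (q (i + 1))) {w y : V} (hw : ∀ i, i ≤ N → q i ≠ w)
    (hy : T.Adj w y) (hd : T.dist w (q c) = T.dist y (q c) + 1) :
    ∀ i, i ≤ N → T.dist w (q i) = T.dist y (q i) + 1 := by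
  have up : ∀ d, c + d ≤ N → T.dist w (q (c + d)) = T.dist y (q (c + d)) + 1 := by
    intro d
    induction d with
    | zero => intro _; exact hd
    | succ d ih =>
      intro hle
      have h1 := ih (by omega)
      rcases tree_adj_dist hT hy (q (c + (d + 1))) with h | h
      · exact h
      · exact absurd (tree_edge_cross hT hy (hq (c + d) (by omega)).symm
          (by rw [← add_assoc] at h; omega) (by omega)) (hw _ (by omega))
  have down : ∀ d, d ≤ c → T.dist w (q (c - d)) = T.dist y (q (c - d)) + 1 := by
    intro d
    induction d with
    | zero => intro _; exact hd
    | succ d ih =>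
      intro hle
      have h1 := ih (by omega)
      rcases tree_adj_dist hT hy (q (c - (d + 1))) with h | h
      · exact h
      · have e : c - (d + 1) + 1 = c - d := by omega
        have ha := hq (c - (d + 1)) (by omega)
        rw [e] at ha
        exact absurd (tree_edge_cross hT hy ha (by omega) (by omega)) (hw _ (by omega))
  intro i hi
  rcases le_total c i with h | h
  · have := up (i - c) (by omega)
    rwa [Nat.add_sub_cancel' h] at this
  · have := down (c - i) (by omega)
    rwa [Nat.sub_sub_self h] at this

theorem dist_seq_le (hT : T.Connected) {N : ℕ} {q : ℕ → V}
    (hq : ∀ i, i < N → T.Adj (q i) (q (i + 1))) (i d : ℕ) (h : i + d ≤ N) :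
    T.dist (q i) (q (i + d)) ≤ d := by
  induction d with
  | zero => simp
  | succ d ih =>
    have h1 := ih (by omega)
    have h2 := SimpleGraph.dist_eq_one_iff_adj.2 (hq (i + d) (by omega))
    have h3 := hT.dist_triangle (u := q i) (v := q (i + d)) (w := q (i + d + 1))
    rw [← add_assoc]
    omega

theorem exists_geodesic (hT : T.Connected) {a b : V} {N : ℕ} (h : T.dist a b = N) :
    ∃ q : ℕ → V, (∀ i, i < N → T.Adj (q i) (q (i + 1))) ∧
      ∀ i d, i + d ≤ N → T.dist (q i) (q (i + d)) = d := by
  obtain ⟨p, hp⟩ := hT.exists_walk_length_eq_dist a b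
  have hq : ∀ i, i < N → T.Adj (p.getVert i) (p.getVert (i + 1)) := fun i hi =>
    p.adj_getVert_succ (by omega)
  refine ⟨p.getVert, hq, fun i d hid => ?_⟩
  have h1 := dist_seq_le hT hq 0 i (by omega)
  have h2 := dist_seq_le hT hq i d hid
  have h3 := dist_seq_le hT hq (i + d) (N - (i + d)) (by omega)
  rw [Nat.add_sub_cancel' hid] at h3
  have hb : p.getVert N = b := by rw [← h, ← hp]; exact p.getVert_length
  simp only [zero_add, SimpleGraph.Walk.getVert_zero] at h1
  rw [hb] at h3
  have t1 := hT.dist_triangle (u := a) (v := p.getVert i) (w := b)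
  have t2 := hT.dist_triangle (u := p.getVert i) (v := p.getVert (i + d)) (w := b)
  omega

end Tree

section Abstract

theorem quad_abs {U : Type*} [Fintype U] [DecidableEq U] (P : Finset U) (x : U → ℝ)
    (hx : ∀ a, 0 < x a) (σ : U → U) (hσ : Function.Involutive σ) (hσP : ∀ a ∈ P, σ a ∈ P)
    (hxσ : ∀ a, x (σ a) = x a) (D : U → U → ℝ) (hD : ∀ a b, D a b = D b a) (par : U → U)
    (h1 : ∀ a ∈ P, ∀ b ∈ P, 0 ≤ D a b)
    (h2 : ∀ w ∉ P, ∀ a ∈ P, (if par w ∈ P then (0 : ℝ) else 2) ≤ D w a + D w (σ a))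
    (h3 : ∀ w ∉ P, ∀ w' ∉ P,
      -(if par w = w' then (1 : ℝ) else 0) - (if par w' = w then (1 : ℝ) else 0) ≤ D w w')
    (hS : ∀ w ∉ P, x w < ∑ a ∈ P, x a) (c : U) (hc : c ∈ P) (hσc : σ c = c) :
    0 ≤ ∑ a, ∑ b, x a * x b * D a b ∧
      (∑ a, ∑ b, x a * x b * D a b ≤ 0 → ∀ w ∉ P, par w ∈ P ∧ D w c ≤ 0) := by
  set L : U → ℝ := fun w => if par w ∈ P then 0 else x (par w) with hL
  have hsym : ∀ w, 2 * ∑ a ∈ P, x a * D w a = ∑ a ∈ P, x a * (D w a + D w (σ a)) := by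
    intro w
    have : ∑ a ∈ P, x a * D w (σ a) = ∑ a ∈ P, x a * D w a := by
      refine Finset.sum_nbij' σ σ hσP hσP (fun a _ => hσ a) (fun a _ => hσ a) (fun a _ => ?_)
      rw [hxσ]
    simp only [mul_add, Finset.sum_add_distrib]
    rw [this]; ring
  have hB : ∀ w ∉ P, (if par w ∈ P then (0 : ℝ) else ∑ a ∈ P, x a) ≤ ∑ a ∈ P, x a * D w a := by
    intro w hw
    have h := hsym w
    have : ∑ a ∈ P, x a * (if par w ∈ P then (0 : ℝ) else 2)
        ≤ ∑ a ∈ P, x a * (D w a + D w (σ a)) :=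
      Finset.sum_le_sum fun a ha => mul_le_mul_of_nonneg_left (h2 w hw a ha) (hx a).le
    rw [← Finset.sum_mul] at this
    split_ifs at this ⊢ <;> linarith
  have hB0 : ∀ w ∈ Pᶜ, 0 ≤ x w * (∑ a ∈ P, x a * D w a - L w) := by
    intro w hw
    rw [Finset.mem_compl] at hw
    refine mul_nonneg (hx w).le ?_
    have h := hB w hw
    simp only [hL]
    split_ifs at h ⊢ with hp
    · linarith
    · linarith [hS _ hp]
  have hPP : 0 ≤ ∑ a ∈ P, ∑ b ∈ P, x a * x b * D a b :=
    Finset.sum_nonneg fun a ha => Finset.sum_nonneg fun b hb =>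
      mul_nonneg (mul_pos (hx a) (hx b)).le (h1 a ha b hb)
  have hLw : ∀ w, ∑ w' ∈ Pᶜ, x w * x w' * (if par w = w' then (1 : ℝ) else 0) = x w * L w := by
    intro w
    simp only [mul_ite, mul_one, mul_zero, Finset.sum_ite_eq, Finset.mem_compl, hL]
    split_ifs <;> simp_all
  have hQQ : -2 * ∑ w ∈ Pᶜ, x w * L w ≤ ∑ w ∈ Pᶜ, ∑ w' ∈ Pᶜ, x w * x w' * D w w' := by
    have e1 : ∑ w ∈ Pᶜ, ∑ w' ∈ Pᶜ, x w * x w' * (if par w = w' then (1 : ℝ) else 0)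
        = ∑ w ∈ Pᶜ, x w * L w := Finset.sum_congr rfl fun w _ => hLw w
    have e2 : ∑ w ∈ Pᶜ, ∑ w' ∈ Pᶜ, x w * x w' * (if par w' = w then (1 : ℝ) else 0)
        = ∑ w ∈ Pᶜ, x w * L w := by
      rw [Finset.sum_comm, ← e1]
      exact Finset.sum_congr rfl fun w _ => Finset.sum_congr rfl fun w' _ => by ring
    have : ∑ w ∈ Pᶜ, ∑ w' ∈ Pᶜ, (-(x w * x w' * (if par w = w' then (1 : ℝ) else 0))
        - (x w * x w' * (if par w' = w then (1 : ℝ) else 0)))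
        ≤ ∑ w ∈ Pᶜ, ∑ w' ∈ Pᶜ, x w * x w' * D w w' := by
      refine Finset.sum_le_sum fun w hw => Finset.sum_le_sum fun w' hw' => ?_
      have := mul_le_mul_of_nonneg_left
        (h3 w (Finset.mem_compl.1 hw) w' (Finset.mem_compl.1 hw')) (mul_pos (hx w) (hx w')).le
      linarith
    simp only [Finset.sum_sub_distrib, Finset.sum_neg_distrib] at this
    rw [e1, e2] at this
    linarith
  have hPQ : ∑ a ∈ P, ∑ w ∈ Pᶜ, x a * x w * D a w = ∑ w ∈ Pᶜ, x w * ∑ a ∈ P, x a * D w a := by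
    rw [Finset.sum_comm]
    refine Finset.sum_congr rfl fun w _ => ?_
    rw [Finset.mul_sum]
    refine Finset.sum_congr rfl fun a _ => ?_
    rw [hD]; ring
  have hQP : ∑ w ∈ Pᶜ, ∑ a ∈ P, x w * x a * D w a = ∑ w ∈ Pᶜ, x w * ∑ a ∈ P, x a * D w a := by
    refine Finset.sum_congr rfl fun w _ => ?_
    rw [Finset.mul_sum]
    refine Finset.sum_congr rfl fun a _ => ?_
    ring
  have htot : ∑ a, ∑ b, x a * x b * D a b = ∑ a ∈ P, ∑ b ∈ P, x a * x b * D a b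
      + 2 * ∑ w ∈ Pᶜ, x w * ∑ a ∈ P, x a * D w a
      + ∑ w ∈ Pᶜ, ∑ w' ∈ Pᶜ, x w * x w' * D w w' := by
    rw [← Finset.sum_add_sum_compl P]
    simp_rw [← Finset.sum_add_sum_compl P (fun b => x _ * x b * D _ b)]
    rw [Finset.sum_add_distrib, Finset.sum_add_distrib, hPQ, hQP]
    ring
  have hge : 2 * ∑ w ∈ Pᶜ, x w * (∑ a ∈ P, x a * D w a - L w)
      ≤ ∑ a, ∑ b, x a * x b * D a b := by
    rw [htot]
    simp only [mul_sub, Finset.sum_sub_distrib]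
    linarith
  have hnn := Finset.sum_nonneg hB0
  refine ⟨by linarith, fun hle w hw => ?_⟩
  have hz := (Finset.sum_eq_zero_iff_of_nonneg hB0).1 (by linarith) w (Finset.mem_compl.2 hw)
  have hz' : ∑ a ∈ P, x a * D w a - L w = 0 :=
    (mul_eq_zero.1 hz).resolve_left (hx w).ne'
  have hBw := hB w hw
  by_cases hp : par w ∈ P
  · refine ⟨hp, ?_⟩
    simp only [hL, hp, if_true, sub_zero] at hz'
    have h := hsym w
    rw [hz', mul_zero] at h
    have h2' := h2 w hw
    simp only [hp, if_true] at h2'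
    have := (Finset.sum_eq_zero_iff_of_nonneg
      (fun a ha => mul_nonneg (hx a).le (h2' a ha))).1 h.symm c hc
    rw [hσc] at this
    have := (mul_eq_zero.1 this).resolve_left (hx c).ne'
    linarith
  · simp only [hL, hp, if_false] at hz' hBw
    linarith [hS _ hp]

theorem three_sum_gt {U : Type*} [Fintype U] (G : SimpleGraph U) (hG : G.Connected)
    (x : U → ℝ) (hx : ∀ a, 0 < x a) (ρ : ℝ)
    (hE : ∀ v, ∑ w, (G.dist v w : ℝ) * x w = ρ * x v) {p c u v : U} (hpc : G.Adj p c)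
    (huv : u ≠ v) : x p < x c + x u + x v := by
  have hρ : 0 < ρ := by
    have : 0 < ρ * x p := by
      rw [← hE]
      refine Finset.sum_pos' (fun w _ => mul_nonneg (Nat.cast_nonneg _) (hx w).le)
        ⟨c, Finset.mem_univ _, mul_pos ?_ (hx c)⟩
      exact_mod_cast hG.pos_dist_of_ne hpc.ne
    exact pos_of_mul_pos_left this (hx p).le
  have h1 := SimpleGraph.dist_eq_one_iff_adj.2 hpc
  have key : ∀ j, G.dist p j ≤ G.dist c j + G.dist u j + G.dist v j := by
    intro j
    have t1 := hG.dist_triangle (u := p) (v := c) (w := j)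
    have t2 := hG.dist_triangle (u := u) (v := j) (w := v)
    rw [SimpleGraph.dist_comm (u := j)] at t2
    have := hG.pos_dist_of_ne huv
    omega
  have : ρ * x p < ρ * (x c + x u + x v) := by
    rw [mul_add, mul_add, ← hE, ← hE, ← hE, ← hE, ← Finset.sum_add_distrib,
      ← Finset.sum_add_distrib]
    refine Finset.sum_lt_sum (fun j _ => ?_) ⟨p, Finset.mem_univ _, ?_⟩
    · rw [← add_mul, ← add_mul]
      refine mul_le_mul_of_nonneg_right ?_ (hx j).le
      exact_mod_cast key j
    · rw [← add_mul, ← add_mul]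
      refine mul_lt_mul_of_pos_right ?_ (hx p)
      have := hG.pos_dist_of_ne hpc.ne'
      rw [SimpleGraph.dist_self]
      exact_mod_cast (by omega : 0 < G.dist c p + G.dist u p + G.dist v p)
  exact lt_of_mul_lt_mul_left this hρ.le

end Abstract

section T2
variable (k m : ℕ)

/-- The vertices of the long path of `T₂`, numbered `0, …, 2k`, with center `k`. -/
def T2r (t : ℕ) : Fin (k + 1) ⊕ (Fin k ⊕ Fin m) :=
  if h : t < k then Sum.inr (Sum.inl ⟨k - 1 - t, by omega⟩)
  else if h' : t ≤ 2 * k then Sum.inl ⟨t - k, by omega⟩ else Sum.inl 0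

/-- Reflection of `T₂`. -/
def T2s : Fin (k + 1) ⊕ (Fin k ⊕ Fin m) → Fin (k + 1) ⊕ (Fin k ⊕ Fin m)
  | Sum.inl i => T2r k m (k - i)
  | Sum.inr (Sum.inl j) => T2r k m (k + 1 + j)
  | Sum.inr (Sum.inr j) => Sum.inr (Sum.inr j)

variable {k m}

theorem T2r_inl (i : Fin (k + 1)) : T2r k m (k + i) = Sum.inl i := by
  have := i.2
  rw [T2r, dif_neg (by omega), dif_pos (by omega)]
  congr 1; ext; simp

theorem T2r_inr (j : Fin k) : T2r k m (k - 1 - j) = Sum.inr (Sum.inl j) := by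
  have := j.2
  rw [T2r, dif_pos (by omega)]
  congr 2; ext; simp; omega

theorem T2r_surj (a : Fin (k + 1) ⊕ (Fin k ⊕ Fin m)) :
    (∃ i ≤ 2 * k, a = T2r k m i) ∨ ∃ j, a = Sum.inr (Sum.inr j) := by
  rcases a with i | j | j
  · exact Or.inl ⟨k + i, by have := i.2; omega, (T2r_inl i).symm⟩
  · exact Or.inl ⟨k - 1 - j, by omega, (T2r_inr j).symm⟩
  · exact Or.inr ⟨j, rfl⟩

theorem T2r_ne (i : ℕ) (j : Fin m) : T2r k m i ≠ Sum.inr (Sum.inr j) := by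
  unfold T2r; split_ifs <;> simp

theorem T2s_r {i : ℕ} (hi : i ≤ 2 * k) : T2s k m (T2r k m i) = T2r k m (2 * k - i) := by
  by_cases h : i < k
  · conv_lhs => rw [T2r, dif_pos h]
    simp only [T2s]
    congr 1; omega
  · conv_lhs => rw [T2r, dif_neg h, dif_pos hi]
    simp only [T2s]
    congr 1; omega

theorem T2s_invol : Function.Involutive (T2s k m) := by
  intro a
  rcases T2r_surj a with ⟨i, hi, rfl⟩ | ⟨j, rfl⟩
  · rw [T2s_r hi, T2s_r (by omega)]; congr 1; omega
  · rfl

theorem T2_adj_r {i : ℕ} (hi : i < 2 * k) : (treeT2 k m).Adj (T2r k m i) (T2r k m (i + 1)) := by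
  unfold treeT2
  rw [SimpleGraph.fromRel_adj]
  unfold T2r
  split_ifs <;> first | omega | (constructor <;> simp <;> omega)

theorem T2_adj_c (j : Fin m) : (treeT2 k m).Adj (T2r k m k) (Sum.inr (Sum.inr j)) := by
  unfold treeT2
  rw [SimpleGraph.fromRel_adj]
  refine ⟨T2r_ne _ _, ?_⟩
  have : T2r k m k = Sum.inl 0 := by simpa using T2r_inl (k := k) (m := m) 0
  rw [this]
  simp

/-- To check a symmetric relation on the edges of `T₂`, it suffices to check the two kinds. -/
theorem T2_adj_ind {R : Fin (k + 1) ⊕ (Fin k ⊕ Fin m) → Fin (k + 1) ⊕ (Fin k ⊕ Fin m) → Prop}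
    (hs : ∀ a b, R a b → R b a) (h1 : ∀ i, i < 2 * k → R (T2r k m i) (T2r k m (i + 1)))
    (h2 : ∀ j, R (T2r k m k) (Sum.inr (Sum.inr j))) {a b} (h : (treeT2 k m).Adj a b) : R a b := by
  have key : ∀ a b : Fin (k + 1) ⊕ (Fin k ⊕ Fin m), (match a, b with
    | Sum.inl i, Sum.inl j => (i : ℕ) + 1 = (j : ℕ)
    | Sum.inr (Sum.inl i), Sum.inr (Sum.inl j) => (i : ℕ) + 1 = (j : ℕ)
    | Sum.inl i, Sum.inr (Sum.inl j) => (i : ℕ) = 0 ∧ (j : ℕ) = 0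
    | Sum.inl i, Sum.inr (Sum.inr _) => (i : ℕ) = 0
    | _, _ => False) → R a b := by
    rintro (i | i | i) (j | j | j) h
    · simp only at h
      have hj := j.2
      rw [← T2r_inl i, ← T2r_inl j, ← h]
      exact h1 _ (by omega)
    · simp only at h
      have hj := j.2
      rw [← T2r_inl i, ← T2r_inr j, h.1, h.2]
      have := h1 (k - 1) (by omega)
      rw [Nat.sub_add_cancel (by omega)] at this
      exact hs _ _ this
    · simp only at h
      rw [← T2r_inl i, h]
      exact h2 j
    · exact h.elim
    · simp only at h
      have hj := j.2
      rw [← T2r_inr i, ← T2r_inr j, ← h]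
      have := h1 (k - 1 - (i + 1)) (by omega)
      rw [show k - 1 - ((i : ℕ) + 1) + 1 = k - 1 - i by omega] at this
      exact hs _ _ this
    · exact h.elim
    · exact h.elim
    · exact h.elim
    · exact h.elim
  unfold treeT2 at h
  rw [SimpleGraph.fromRel_adj] at h
  rcases h.2 with h | h
  · exact key a b h
  · exact hs _ _ (key b a h)

theorem T2_conn : (treeT2 k m).Connected := by
  have h0 : ∀ i, i ≤ 2 * k → (treeT2 k m).Reachable (T2r k m 0) (T2r k m i) := by
    intro i
    induction i with
    | zero => intro _; rfl
    | succ i ih => intro hi; exact (ih (by omega)).trans (T2_adj_r (by omega)).reachable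
  have h1 : ∀ a, (treeT2 k m).Reachable (T2r k m 0) a := by
    intro a
    rcases T2r_surj a with ⟨i, hi, rfl⟩ | ⟨j, rfl⟩
    · exact h0 i hi
    · exact (h0 k (by omega)).trans (T2_adj_c j).reachable
  exact { preconnected := fun a b => (h1 a).symm.trans (h1 b), nonempty := ⟨Sum.inl 0⟩ }

/-- The reflection as a graph automorphism. -/
def T2sIso (k m : ℕ) : treeT2 k m ≃g treeT2 k m where
  toEquiv := T2s_invol.toPerm
  map_rel_iff' := by
    have key : ∀ a b, (treeT2 k m).Adj a b → (treeT2 k m).Adj (T2s k m a) (T2s k m b) := by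
      intro a b h
      refine T2_adj_ind (R := fun a b => (treeT2 k m).Adj (T2s k m a) (T2s k m b))
        (fun a b h => h.symm) ?_ ?_ h
      · intro i hi
        rw [T2s_r (by omega), T2s_r (by omega)]
        have := T2_adj_r (k := k) (m := m) (i := 2 * k - (i + 1)) (by omega)
        rw [show 2 * k - (i + 1) + 1 = 2 * k - i by omega] at this
        exact this.symm
      · intro j
        rw [T2s_r (by omega), show 2 * k - k = k by omega]
        exact T2_adj_c j
    intro a b
    refine ⟨fun h => ?_, key a b⟩
    have := key _ _ h
    simpa [T2s_invol a, T2s_invol b] using this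

theorem T2_dist_s (a b) :
    (treeT2 k m).dist (T2s k m a) (T2s k m b) = (treeT2 k m).dist a b :=
  dist_iso T2_conn T2_conn (T2sIso k m) a b

/-- Symmetric positive eigenvector for `T₂`. -/
theorem T2_perron (hk : 1 ≤ k) : ∃ X : Fin (k + 1) ⊕ (Fin k ⊕ Fin m) → ℝ, (∀ v, 0 < X v) ∧
    (∀ v, X (T2s k m v) = X v) ∧
    ∀ v, ∑ w, ((treeT2 k m).dist v w : ℝ) * X w = distSpectralRadius (treeT2 k m) * X v := by
  haveI : Nontrivial (Fin (k + 1) ⊕ (Fin k ⊕ Fin m)) :=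
    ⟨⟨Sum.inl 0, Sum.inr (Sum.inl ⟨0, hk⟩), by simp⟩⟩
  obtain ⟨Y, hY, hE⟩ := dsr_perron (treeT2 k m) T2_conn
  refine ⟨fun v => Y v + Y (T2s k m v), fun v => add_pos (hY _) (hY _), fun v => ?_, fun v => ?_⟩
  · simp only [T2s_invol v]; ring
  · simp only [mul_add, Finset.sum_add_distrib]
    rw [← hE, ← hE]
    congr 1
    rw [← Equiv.sum_comp (T2s_invol (k := k) (m := m)).toPerm]
    refine Finset.sum_congr rfl fun w _ => ?_
    simp only [Function.Involutive.coe_toPerm, T2s_invol w]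
    rw [← T2_dist_s v, T2s_invol w]

end T2

section Main
variable {V : Type*} [Fintype V] {T : SimpleGraph V} {k m : ℕ}

theorem exists_labelling (hcard : Fintype.card V = 2 * k + 1 + m) {q : ℕ → V}
    (hq : ∀ i j, i ≤ 2 * k → j ≤ 2 * k → q i = q j → i = j) :
    ∃ e : (Fin (k + 1) ⊕ (Fin k ⊕ Fin m)) ≃ V, ∀ i, i ≤ 2 * k → e (T2r k m i) = q i := by
  classical
  set I : Finset V := (Finset.range (2 * k + 1)).image q with hI
  have hIc : I.card = 2 * k + 1 := by
    rw [hI, Finset.card_image_of_injOn, Finset.card_range]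
    intro i hi j hj h
    simp at hi hj
    exact hq i j (by omega) (by omega) h
  have hmem : ∀ i, i ≤ 2 * k → q i ∈ I := fun i hi =>
    Finset.mem_image.2 ⟨i, by simp; omega, rfl⟩
  have hcc : Fintype.card (↥(Iᶜ)) = m := by
    rw [Fintype.card_coe, Finset.card_compl, hIc, hcard]; omega
  let f := (Fintype.equivFinOfCardEq hcc).symm
  have hf : ∀ j i, i ≤ 2 * k → q i ≠ (f j : V) := fun j i hi h => by
    have := (f j).2
    rw [Finset.mem_compl, ← h] at this
    exact this (hmem i hi)
  let g : (Fin (k + 1) ⊕ (Fin k ⊕ Fin m)) → V := fun a => match a with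
    | Sum.inl i => q (k + i)
    | Sum.inr (Sum.inl j) => q (k - 1 - j)
    | Sum.inr (Sum.inr j) => f j
  have hg : ∀ i, i ≤ 2 * k → g (T2r k m i) = q i := by
    intro i hi
    by_cases h : i < k
    · rw [T2r, dif_pos h]
      simp only [g]; congr 1; omega
    · rw [T2r, dif_neg h, dif_pos hi]
      simp only [g]; congr 1; omega
  have hinj : Function.Injective g := by
    intro a b hab
    rcases T2r_surj a with ⟨i, hi, rfl⟩ | ⟨i, rfl⟩ <;> rcases T2r_surj b with ⟨j, hj, rfl⟩ | ⟨j, rfl⟩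
    · rw [hg i hi, hg j hj] at hab
      rw [hq i j hi hj hab]
    · rw [hg i hi] at hab
      exact absurd hab (hf j i hi)
    · rw [hg j hj] at hab
      exact absurd hab.symm (hf i j hj)
    · have : f i = f j := Subtype.ext hab
      rw [f.injective this]
  have hbij : Function.Bijective g := by
    rw [Fintype.bijective_iff_injective_and_card]
    refine ⟨hinj, ?_⟩
    simp [hcard]; omega
  exact ⟨Equiv.ofBijective g hbij, hg⟩

theorem main_aux (hk : 1 ≤ k) (hcard : Fintype.card V = 2 * k + 1 + m) (hT : T.IsTree)
    (hdiam : T.diam = 2 * k) :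
    distSpectralRadius (treeT2 k m) ≤ distSpectralRadius T ∧
      (distSpectralRadius T ≤ distSpectralRadius (treeT2 k m) → Nonempty (T ≃g treeT2 k m)) := by
  classical
  have hconn := hT.connected
  haveI : Nonempty V := hconn.nonempty
  obtain ⟨a₀, b₀, hab⟩ := T.exists_dist_eq_diam
  obtain ⟨q, hqa, hqd⟩ := exists_geodesic hconn (hab.trans hdiam)
  have hqinj : ∀ i j, i ≤ 2 * k → j ≤ 2 * k → q i = q j → i = j := by
    have : ∀ i d, i + d ≤ 2 * k → q i = q (i + d) → d = 0 := by
      intro i d h1 h2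
      have := hqd i d h1
      rw [← h2, SimpleGraph.dist_self] at this
      exact this.symm
    intro i j hi hj h
    rcases le_total i j with hl | hl
    · obtain ⟨d, rfl⟩ := Nat.exists_eq_add_of_le hl
      have := this i d hj h
      omega
    · obtain ⟨d, rfl⟩ := Nat.exists_eq_add_of_le hl
      have := this j d hi h.symm
      omega
  obtain ⟨e, he⟩ := exists_labelling hcard hqinj
  obtain ⟨x, hx, hxs, hE⟩ := T2_perron (m := m) hk
  -- parents
  have hpar : ∀ v, ∃ y, v ≠ q k → T.Adj v y ∧ T.dist v (q k) = T.dist y (q k) + 1 := by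
    intro v
    by_cases h : v = q k
    · exact ⟨v, fun h' => absurd h h'⟩
    · obtain ⟨y, hy⟩ := exists_closer hconn h
      exact ⟨y, fun _ => hy⟩
  choose pr hpr using hpar
  set P : Finset (Fin (k + 1) ⊕ (Fin k ⊕ Fin m)) := (Finset.range (2 * k + 1)).image (T2r k m) with hP
  have hPmem : ∀ a, a ∈ P ↔ ∃ i, i ≤ 2 * k ∧ T2r k m i = a := by
    intro a
    simp [hP, Nat.lt_succ_iff]
  have hPr : ∀ i, i ≤ 2 * k → T2r k m i ∈ P := fun i hi => (hPmem _).2 ⟨i, hi, rfl⟩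
  have hPn : ∀ a, a ∉ P → ∃ j, a = Sum.inr (Sum.inr j) := by
    intro a ha
    rcases T2r_surj a with ⟨i, hi, rfl⟩ | h
    · exact absurd (hPr i hi) ha
    · exact h
  have hnP : ∀ j : Fin m, (Sum.inr (Sum.inr j) : Fin (k + 1) ⊕ (Fin k ⊕ Fin m)) ∉ P := by
    intro j h
    obtain ⟨i, -, hi⟩ := (hPmem _).1 h
    exact T2r_ne _ _ hi
  have hoff : ∀ w, w ∉ P → ∀ i, i ≤ 2 * k → q i ≠ e w := by
    intro w hw i hi h
    rw [← he i hi] at h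
    exact hw (e.injective h ▸ hPr i hi)
  have hpp : ∀ w, w ∉ P → ∀ i, i ≤ 2 * k → T.dist (e w) (q i) = T.dist (pr (e w)) (q i) + 1 := by
    intro w hw
    have h := hpr (e w) (hoff w hw k (by omega)).symm
    exact tree_parent_path hT (c := k) (by omega) hqa (hoff w hw) h.1 h.2
  -- distances in T₂
  have d2path : ∀ i d, i + d ≤ 2 * k → (treeT2 k m).dist (T2r k m i) (T2r k m (i + d)) ≤ d :=
    fun i d h => dist_seq_le (q := T2r k m) (N := 2 * k) T2_conn (fun _ hi => T2_adj_r hi) i d h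
  have d2pc : ∀ j : Fin m, (treeT2 k m).dist (Sum.inr (Sum.inr j)) (T2r k m k) = 1 := fun j =>
    SimpleGraph.dist_eq_one_iff_adj.2 (T2_adj_c j).symm
  have hPP : ∀ i j, i ≤ 2 * k → j ≤ 2 * k →
      (treeT2 k m).dist (T2r k m i) (T2r k m j) ≤ T.dist (q i) (q j) := by
    intro i j hi hj
    rcases le_total i j with hl | hl
    · obtain ⟨d, rfl⟩ := Nat.exists_eq_add_of_le hl
      rw [hqd i d hj]; exact d2path i d hj
    · obtain ⟨d, rfl⟩ := Nat.exists_eq_add_of_le hl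
      rw [SimpleGraph.dist_comm, SimpleGraph.dist_comm (u := q (j + d)), hqd j d hi]
      exact d2path j d hi
  have hQQ : ∀ w w', w ∉ P → w' ∉ P → (treeT2 k m).dist w w' ≤ 2 := by
    intro w w' hw hw'
    obtain ⟨j, rfl⟩ := hPn w hw
    obtain ⟨j', rfl⟩ := hPn w' hw'
    have t := (T2_conn (k := k) (m := m)).dist_triangle (u := Sum.inr (Sum.inr j))
      (v := T2r k m k) (w := Sum.inr (Sum.inr j'))
    rw [SimpleGraph.dist_comm (u := T2r k m k), d2pc, d2pc] at t
    exact t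
  have hQP : ∀ w, w ∉ P → ∀ i, i ≤ 2 * k → (treeT2 k m).dist w (T2r k m i)
      + (treeT2 k m).dist w (T2r k m (2 * k - i)) ≤ 2 + T.dist (q i) (q (2 * k - i)) := by
    intro w hw
    obtain ⟨j, rfl⟩ := hPn w hw
    have half : ∀ d, d ≤ k → (treeT2 k m).dist (Sum.inr (Sum.inr j)) (T2r k m (k - d))
      + (treeT2 k m).dist (Sum.inr (Sum.inr j)) (T2r k m (k + d)) ≤ 2 + 2 * d := by
      intro d hd
      have t1 := (T2_conn (k := k) (m := m)).dist_triangle (u := Sum.inr (Sum.inr j))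
        (v := T2r k m k) (w := T2r k m (k - d))
      have t2 := (T2_conn (k := k) (m := m)).dist_triangle (u := Sum.inr (Sum.inr j))
        (v := T2r k m k) (w := T2r k m (k + d))
      have s1 := d2path (k - d) d (by omega)
      have s2 := d2path k d (by omega)
      rw [Nat.sub_add_cancel hd, SimpleGraph.dist_comm] at s1
      rw [d2pc] at t1 t2
      omega
    intro i hi
    rcases le_total i k with hl | hl
    · have h := half (k - i) (by omega)
      have h2 := hqd i (2 * (k - i)) (by omega)
      rw [show k - (k - i) = i by omega, show k + (k - i) = 2 * k - i by omega] at h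
      rw [show i + 2 * (k - i) = 2 * k - i by omega] at h2
      omega
    · have h := half (i - k) (by omega)
      have h2 := hqd (2 * k - i) (2 * (i - k)) (by omega)
      rw [show k - (i - k) = 2 * k - i by omega, show k + (i - k) = i by omega] at h
      rw [show 2 * k - i + 2 * (i - k) = i by omega, SimpleGraph.dist_comm] at h2
      omega
  -- the main inequality
  have hmain := quad_abs P x hx (T2s k m) T2s_invol
    (by
      intro a ha
      obtain ⟨i, hi, rfl⟩ := (hPmem _).1 ha
      rw [T2s_r hi]
      exact hPr _ (by omega))
    hxs (fun a b => (T.dist (e a) (e b) : ℝ) - ((treeT2 k m).dist a b : ℝ))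
    (by
      intro a b
      rw [SimpleGraph.dist_comm, SimpleGraph.dist_comm (u := a)])
    (fun w => e.symm (pr (e w)))
    (by
      intro a ha b hb
      obtain ⟨i, hi, rfl⟩ := (hPmem _).1 ha
      obtain ⟨j, hj, rfl⟩ := (hPmem _).1 hb
      rw [he i hi, he j hj, sub_nonneg]
      exact_mod_cast hPP i j hi hj)
    (by
      intro w hw a ha
      obtain ⟨i, hi, rfl⟩ := (hPmem _).1 ha
      rw [T2s_r hi, he i hi, he _ (by omega : 2 * k - i ≤ 2 * k)]
      have e1 := hpp w hw i hi
      have e2 := hpp w hw (2 * k - i) (by omega)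
      have u1 := hQP w hw i hi
      have key : ∀ z, T.dist (q i) (q (2 * k - i)) ≤
          T.dist z (q i) + T.dist z (q (2 * k - i)) := by
        intro z
        have := hconn.dist_triangle (u := q i) (v := z) (w := q (2 * k - i))
        rwa [SimpleGraph.dist_comm (u := q i) (v := z)] at this
      split_ifs with hp
      · have t := key (pr (e w))
        have : (treeT2 k m).dist w (T2r k m i) + (treeT2 k m).dist w (T2r k m (2 * k - i))
          ≤ T.dist (e w) (q i) + T.dist (e w) (q (2 * k - i)) := by omega
        have : (((treeT2 k m).dist w (T2r k m i) : ℝ) + (treeT2 k m).dist w (T2r k m (2 * k - i)))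
          ≤ T.dist (e w) (q i) + T.dist (e w) (q (2 * k - i)) := by exact_mod_cast this
        linarith
      · have f1 := hpp _ hp i hi
        have f2 := hpp _ hp (2 * k - i) (by omega)
        rw [Equiv.apply_symm_apply] at f1 f2
        have t := key (pr (pr (e w)))
        have : 2 + ((treeT2 k m).dist w (T2r k m i) + (treeT2 k m).dist w (T2r k m (2 * k - i)))
          ≤ T.dist (e w) (q i) + T.dist (e w) (q (2 * k - i)) := by omega
        have : 2 + (((treeT2 k m).dist w (T2r k m i) : ℝ)
          + (treeT2 k m).dist w (T2r k m (2 * k - i)))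
          ≤ T.dist (e w) (q i) + T.dist (e w) (q (2 * k - i)) := by exact_mod_cast this
        linarith)
    (by
      intro w hw w' hw'
      by_cases hww : w = w'
      · subst hww
        simp only [SimpleGraph.dist_self, sub_self]
        split_ifs <;> norm_num
      have h2 := hQQ w w' hw hw'
      have h2' : ((treeT2 k m).dist w w' : ℝ) ≤ 2 := by exact_mod_cast h2
      have hpos := hconn.pos_dist_of_ne (e.injective.ne hww)
      by_cases h1 : T.dist (e w) (e w') = 1
      · have hadj := SimpleGraph.dist_eq_one_iff_adj.1 h1
        have g1 := hpr (e w) (hoff w hw k (by omega)).symm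
        have g2 := hpr (e w') (hoff w' hw' k (by omega)).symm
        rw [h1]
        have : e.symm (pr (e w)) = w' ∨ e.symm (pr (e w')) = w := by
          rcases tree_adj_dist hT hadj (q k) with h | h
          · left
            rw [tree_closer_unique hT g1.1 hadj (z := q k) (by omega) (by omega)]
            simp
          · right
            rw [tree_closer_unique hT g2.1 hadj.symm (z := q k) (by omega) (by omega)]
            simp
        rcases this with h | h
        · rw [if_pos h]
          push_cast
          split_ifs <;> linarith
        · rw [if_pos h]
          push_cast
          split_ifs <;> linarith
      · have : (2 : ℝ) ≤ T.dist (e w) (e w') := by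
          exact_mod_cast (by omega : 2 ≤ T.dist (e w) (e w'))
        split_ifs <;> linarith)
    (by
      intro w hw
      obtain ⟨j, rfl⟩ := hPn w hw
      have huv : T2r k m (k - 1) ≠ T2r k m (k + 1) := by
        intro h
        have h1 := he (k - 1) (by omega)
        rw [h, he (k + 1) (by omega)] at h1
        have := hqinj _ _ (by omega) (by omega) h1
        omega
      have hcu : T2r k m k ≠ T2r k m (k - 1) := by
        intro h
        have h1 := he k (by omega)
        rw [h, he (k - 1) (by omega)] at h1
        have := hqinj _ _ (by omega) (by omega) h1
        omega
      have hcv : T2r k m k ≠ T2r k m (k + 1) := by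
        intro h
        have h1 := he k (by omega)
        rw [h, he (k + 1) (by omega)] at h1
        have := hqinj _ _ (by omega) (by omega) h1
        omega
      refine (three_sum_gt _ T2_conn x hx _ hE (T2_adj_c j).symm huv).trans_le ?_
      have hsub : ({T2r k m k, T2r k m (k - 1), T2r k m (k + 1)} : Finset (Fin (k + 1) ⊕ (Fin k ⊕ Fin m))) ⊆ P := by
        intro a ha
        simp only [Finset.mem_insert, Finset.mem_singleton] at ha
        rcases ha with rfl | rfl | rfl <;> exact hPr _ (by omega)
      have := Finset.sum_le_sum_of_subset_of_nonneg hsub (f := x) (fun a _ _ => (hx a).le)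
      rw [Finset.sum_insert (by simp [hcu, hcv]), Finset.sum_pair huv] at this
      linarith)
    (T2r k m k) (hPr k (by omega))
    (by rw [T2s_r (by omega)]; congr 1; omega)
  have hsq : 0 < ∑ a, x a ^ 2 :=
    Finset.sum_pos (fun a _ => pow_pos (hx a) 2) ⟨Sum.inl 0, Finset.mem_univ _⟩
  have hT2 : ∑ a, ∑ b, x a * x b * ((treeT2 k m).dist a b : ℝ)
      = distSpectralRadius (treeT2 k m) * ∑ a, x a ^ 2 := by
    rw [Finset.mul_sum]
    refine Finset.sum_congr rfl fun v _ => ?_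
    calc _ = x v * ∑ w, ((treeT2 k m).dist v w : ℝ) * x w := by
          rw [Finset.mul_sum]; exact Finset.sum_congr rfl fun w _ => by ring
      _ = _ := by rw [hE]; ring
  have hTT : ∑ a, ∑ b, x a * x b * (T.dist (e a) (e b) : ℝ)
      ≤ distSpectralRadius T * ∑ a, x a ^ 2 := by
    have := dsr_rayleigh T (fun v => x (e.symm v))
    rw [← Equiv.sum_comp e, ← Equiv.sum_comp e] at this
    simp_rw [← Equiv.sum_comp e (fun w => x (e.symm _) * x (e.symm w) * (T.dist _ w : ℝ))] at this
    simpa using this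
  simp only [mul_sub, Finset.sum_sub_distrib, hT2] at hmain
  obtain ⟨hm1, hm2⟩ := hmain
  refine ⟨le_of_mul_le_mul_right (by linarith) hsq, fun hle => ?_⟩
  have hm3 := hm2 (by
    have := mul_le_mul_of_nonneg_right hle hsq.le
    linarith)
  have hadjc : ∀ j : Fin m, T.dist (e (Sum.inr (Sum.inr j))) (q k) = 1 := by
    intro j
    have h := (hm3 _ (hnP j)).2
    rw [d2pc, he k (by omega), sub_nonpos] at h
    have h' : T.dist (e (Sum.inr (Sum.inr j))) (q k) ≤ 1 := by exact_mod_cast h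
    have := hconn.pos_dist_of_ne (hoff _ (hnP j) k (by omega)).symm
    omega
  have hpend : ∀ j : Fin m, ∀ i, i ≤ 2 * k → T.Adj (e (Sum.inr (Sum.inr j))) (q i) → i = k := by
    intro j i hi h
    have hc := hadjc j
    have := tree_parent_path hT (c := k) (by omega) hqa (hoff _ (hnP j))
      (SimpleGraph.dist_eq_one_iff_adj.1 hc) (by rw [hc, SimpleGraph.dist_self]) i hi
    rw [SimpleGraph.dist_eq_one_iff_adj.2 h] at this
    have h0 : T.dist (q k) (q i) = 0 := by omega
    exact (hqinj _ _ (by omega) hi (hconn.dist_eq_zero_iff.1 h0)).symm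
  have fwd : ∀ a b, (treeT2 k m).Adj a b → T.Adj (e a) (e b) := by
    intro a b h
    refine T2_adj_ind (R := fun a b => T.Adj (e a) (e b)) (fun a b h => h.symm) ?_ ?_ h
    · intro i hi
      rw [he i (by omega), he (i + 1) (by omega)]
      exact hqa i hi
    · intro j
      rw [he k (by omega)]
      exact (SimpleGraph.dist_eq_one_iff_adj.1 (hadjc j)).symm
  have bwd : ∀ a b, T.Adj (e a) (e b) → (treeT2 k m).Adj a b := by
    intro a b h
    rcases T2r_surj a with ⟨i, hi, rfl⟩ | ⟨i, rfl⟩ <;> rcases T2r_surj b with ⟨j, hj, rfl⟩ | ⟨j, rfl⟩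
    · rw [he i hi, he j hj] at h
      have h1 := SimpleGraph.dist_eq_one_iff_adj.2 h
      rcases le_total i j with hl | hl
      · obtain ⟨d, rfl⟩ := Nat.exists_eq_add_of_le hl
        rw [hqd i d hj] at h1
        subst h1
        exact T2_adj_r (by omega)
      · obtain ⟨d, rfl⟩ := Nat.exists_eq_add_of_le hl
        rw [SimpleGraph.dist_comm, hqd j d hi] at h1
        subst h1
        exact (T2_adj_r (by omega)).symm
    · rw [he i hi] at h
      rw [hpend j i hi h.symm]
      exact T2_adj_c j
    · rw [he j hj] at h
      rw [hpend i j hj h]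
      exact (T2_adj_c i).symm
    · have h1 := hadjc i
      have h2 := hadjc j
      have := tree_adj_dist hT h (q k)
      omega
  exact ⟨RelIso.symm ⟨e, fun {a b} => ⟨bwd a b, fwd a b⟩⟩⟩

end Main

/-- Even diameter case: among all trees on `n` vertices with diameter `2k` (`k ≥ 1`), the
distance spectral radius is minimized uniquely by the tree `T₂` obtained by attaching
`n - 2k - 1` pendant vertices at the center `v_0` of the path `v_k ⋯ v_1 v_0 u_1 ⋯ u_k`. -/
theorem stmt9 {V : Type*} [Fintype V] (n k : ℕ) (hk : 1 ≤ k) (h2k : 2 * k + 1 ≤ n)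
    (T : SimpleGraph V) (hcard : Fintype.card V = n)
    (hconn : T.Connected) (hacyc : T.IsAcyclic) (hdiam : T.diam = 2 * k) :
    distSpectralRadius T ≥ distSpectralRadius (treeT2 k (n - 2 * k - 1)) ∧
    (distSpectralRadius T = distSpectralRadius (treeT2 k (n - 2 * k - 1)) ↔
      Nonempty (T ≃g treeT2 k (n - 2 * k - 1))) := by
  have hT : T.IsTree := ⟨hconn, hacyc⟩
  haveI : Nonempty V := hconn.nonempty
  obtain ⟨h1, h2⟩ := main_aux (m := n - 2 * k - 1) hk (by omega) hT hdiam
  refine ⟨h1, fun h => h2 h.le, fun ⟨f⟩ => le_antisymm ?_ h1⟩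
  exact dsr_iso_le hconn T2_conn f
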